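/- Let H₁ and H₂ be invertible Hermitian n×n complex matrices with H₁ ≤ H₂. If H₁ and H₂ have the same inertia, then H₂⁻¹ ≤ H₁⁻¹. -/

import Mathlib

open Matrix ComplexOrder

/-- Number of strictly negative eigenvalues (with multiplicity) of a matrix,
interpreted via its Hermitian spectral decomposition (0 if not Hermitian). -/
noncomputable def negCount {n : ℕ} (A : Matrix (Fin n) (Fin n) ℂ) : ℕ :=
  if h : A.IsHermitian then Fintype.card {i // h.eigenvalues i < 0} else 0

/-- Number of strictly positive eigenvalues. -/
noncomputable def posCount {n : ℕ} (A : Matrix (Fin n) (Fin n) ℂ) : ℕ :=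
  if h : A.IsHermitian then Fintype.card {i // 0 < h.eigenvalues i} else 0

/-- Number of nonpositive eigenvalues. -/
noncomputable def nonposCount {n : ℕ} (A : Matrix (Fin n) (Fin n) ℂ) : ℕ :=
  if h : A.IsHermitian then Fintype.card {i // h.eigenvalues i ≤ 0} else 0

/-- Number of nonnegative eigenvalues. -/
noncomputable def nonnegCount {n : ℕ} (A : Matrix (Fin n) (Fin n) ℂ) : ℕ :=
  if h : A.IsHermitian then Fintype.card {i // 0 ≤ h.eigenvalues i} else 0

/-- Number of zero eigenvalues. -/
noncomputable def zeroCount {n : ℕ} (A : Matrix (Fin n) (Fin n) ℂ) : ℕ :=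
  if h : A.IsHermitian then Fintype.card {i // h.eigenvalues i = 0} else 0

namespace Matrix

variable {m p q : Type*} [Fintype m]

lemma star_mulVec_dotProduct_mulVec_mulVec [Fintype p] (A : Matrix m m ℂ) (E : Matrix m p ℂ)
    (u : p → ℂ) :
    star (E *ᵥ u) ⬝ᵥ A *ᵥ (E *ᵥ u) = star u ⬝ᵥ (Eᴴ * A * E) *ᵥ u := by
  simp only [star_mulVec, ← mulVec_mulVec, dotProduct_mulVec, vecMul_vecMul]

lemma IsHermitian.conjTranspose_submatrix_eigenvectorUnitary_mul_mul [DecidableEq m]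
    [DecidableEq p] {A : Matrix m m ℂ} (hA : A.IsHermitian) {e : p → m}
    (he : Function.Injective e) :
    ((hA.eigenvectorUnitary : Matrix m m ℂ).submatrix id e)ᴴ * A *
      (hA.eigenvectorUnitary : Matrix m m ℂ).submatrix id e =
        diagonal fun i ↦ (hA.eigenvalues (e i) : ℂ) := by
  have h := hA.conjStarAlgAut_star_eigenvectorUnitary
  rw [Unitary.conjStarAlgAut_star_apply] at h
  have h' := congrArg (fun M : Matrix m m ℂ ↦ M.submatrix e e) h
  rw [submatrix_diagonal _ _ he] at h'
  exact h'

lemma surjective_coprod_mulVecLin_of_posDef [Fintype p] [Fintype q] {A B : Matrix m m ℂ}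
    (hAB : (B - A).PosSemidef) {E : Matrix m p ℂ} {F : Matrix m q ℂ} (hE : (Eᴴ * A * E).PosDef)
    (hF : (Fᴴ * (-B) * F).PosDef)
    (hcard : Fintype.card p + Fintype.card q = Fintype.card m) :
    Function.Surjective (E.mulVecLin.coprod F.mulVecLin) := by
  refine (LinearMap.injective_iff_surjective_of_finrank_eq_finrank (by simpa using hcard)).1 ?_
  rw [injective_iff_map_eq_zero]
  rintro ⟨u, v⟩ huv
  have huv' : F *ᵥ v = -(E *ᵥ u) := by
    rw [eq_neg_iff_add_eq_zero, add_comm]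
    simpa using huv
  have h₁ := hE.posSemidef.dotProduct_mulVec_nonneg u
  have h₂ := hF.posSemidef.dotProduct_mulVec_nonneg v
  have h₃ := hAB.dotProduct_mulVec_nonneg (E *ᵥ u)
  have hEu := star_mulVec_dotProduct_mulVec_mulVec A E u
  have hFv := star_mulVec_dotProduct_mulVec_mulVec (-B) F v
  rw [huv'] at hFv
  simp only [star_neg, mulVec_neg, neg_mulVec, neg_dotProduct, neg_neg] at hFv
  rw [sub_mulVec, dotProduct_sub, hEu, ← neg_eq_iff_eq_neg.2 hFv.symm] at h₃
  have hsum : star u ⬝ᵥ (Eᴴ * A * E) *ᵥ u + star v ⬝ᵥ (Fᴴ * (-B) * F) *ᵥ v ≤ 0 := by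
    rw [← sub_nonneg]
    convert h₃ using 1
    ring
  refine Prod.ext ?_ ?_
  · by_contra hu
    exact ((add_pos_of_pos_of_nonneg (hE.dotProduct_mulVec_pos hu) h₂).trans_le hsum).false
  · by_contra hv
    exact ((add_pos_of_nonneg_of_pos h₁ (hF.dotProduct_mulVec_pos hv)).trans_le hsum).false

/-- If vectors `a` and `b` satisfy `A⁻¹ x + a = B⁻¹ x + b`, then the gap between the quadratic
forms of `A⁻¹` and `B⁻¹` at `x` splits into the values of `A`, `-B` and `B - A` at `a`, `b` and
the common point. -/
lemma dotProduct_inv_sub_inv_mulVec [DecidableEq m] {A B : Matrix m m ℂ} (hA : A.IsHermitian)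
    (hB : B.IsHermitian) (hAu : IsUnit A) (hBu : IsUnit B) {x a b : m → ℂ}
    (hab : A⁻¹ *ᵥ x + a = B⁻¹ *ᵥ x + b) :
    star x ⬝ᵥ (A⁻¹ - B⁻¹) *ᵥ x = star a ⬝ᵥ A *ᵥ a + star b ⬝ᵥ (-B) *ᵥ b +
      star (A⁻¹ *ᵥ x + a) ⬝ᵥ (B - A) *ᵥ (A⁻¹ *ᵥ x + a) := by
  have expand {C : Matrix m m ℂ} (hC : C.IsHermitian) (hCu : IsUnit C) (c : m → ℂ) :
      star (C⁻¹ *ᵥ x + c) ⬝ᵥ C *ᵥ (C⁻¹ *ᵥ x + c) =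
        star (C⁻¹ *ᵥ x + c) ⬝ᵥ x + star x ⬝ᵥ (C⁻¹ *ᵥ x + c) - star x ⬝ᵥ C⁻¹ *ᵥ x
          + star c ⬝ᵥ C *ᵥ c := by
    have hdet := (isUnit_iff_isUnit_det C).1 hCu
    have h₁ : C *ᵥ (C⁻¹ *ᵥ x) = x := by
      rw [mulVec_mulVec, mul_nonsing_inv C hdet, one_mulVec]
    have h₂ : star (C⁻¹ *ᵥ x) ⬝ᵥ C *ᵥ c = star x ⬝ᵥ c := by
      rw [dotProduct_mulVec, star_mulVec, hC.inv.eq, vecMul_vecMul, nonsing_inv_mul C hdet,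
        vecMul_one]
    simp only [mulVec_add, h₁, star_add, add_dotProduct, dotProduct_add, h₂]
    ring
  have hA' := expand hA hAu a
  have hB' := expand hB hBu b
  rw [← hab] at hB'
  simp only [sub_mulVec, neg_mulVec, dotProduct_sub, dotProduct_neg]
  rw [hA', hB']
  ring

lemma posSemidef_inv_sub_inv_of_posDef [Fintype p] [Fintype q] [DecidableEq m] {A B : Matrix m m ℂ}
    (hA : A.IsHermitian) (hB : B.IsHermitian) (hAu : IsUnit A) (hBu : IsUnit B)
    (hAB : (B - A).PosSemidef) {E : Matrix m p ℂ} {F : Matrix m q ℂ}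
    (hE : (Eᴴ * A * E).PosDef) (hF : (Fᴴ * (-B) * F).PosDef)
    (hcard : Fintype.card p + Fintype.card q = Fintype.card m) :
    (A⁻¹ - B⁻¹).PosSemidef := by
  refine .of_dotProduct_mulVec_nonneg (hA.inv.sub hB.inv) fun x ↦ ?_
  obtain ⟨⟨u, v⟩, huv⟩ :=
    surjective_coprod_mulVecLin_of_posDef hAB hE hF hcard (B⁻¹ *ᵥ x - A⁻¹ *ᵥ x)
  simp only [LinearMap.coprod_apply, mulVecLin_apply] at huv
  have hab : A⁻¹ *ᵥ x + E *ᵥ u = B⁻¹ *ᵥ x + F *ᵥ (-v) := by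
    rw [mulVec_neg, ← sub_eq_add_neg, eq_sub_iff_add_eq, add_assoc, huv, add_sub_cancel]
  rw [dotProduct_inv_sub_inv_mulVec hA hB hAu hBu hab, star_mulVec_dotProduct_mulVec_mulVec,
    star_mulVec_dotProduct_mulVec_mulVec]
  exact add_nonneg (add_nonneg (hE.posSemidef.dotProduct_mulVec_nonneg u)
    (hF.posSemidef.dotProduct_mulVec_nonneg (-v))) (hAB.dotProduct_mulVec_nonneg _)

lemma IsHermitian.eigenvalues_ne_zero_of_isUnit [DecidableEq m] {A : Matrix m m ℂ}
    (hA : A.IsHermitian) (hAu : IsUnit A) (i : m) : hA.eigenvalues i ≠ 0 := by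
  have hdet := ((isUnit_iff_isUnit_det A).1 hAu).ne_zero
  rw [hA.det_eq_prod_eigenvalues, Finset.prod_ne_zero_iff] at hdet
  simpa using hdet i (Finset.mem_univ i)

end Matrix

lemma posCount_add_negCount_of_isUnit {n : ℕ} {A : Matrix (Fin n) (Fin n) ℂ}
    (hA : A.IsHermitian) (hAu : IsUnit A) : posCount A + negCount A = n := by
  rw [posCount, negCount, dif_pos hA, dif_pos hA]
  have h := Fintype.card_subtype_compl fun i ↦ 0 < hA.eigenvalues i
  have hle := Fintype.card_subtype_le fun i ↦ 0 < hA.eigenvalues i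
  have hneg : Fintype.card {i // hA.eigenvalues i < 0} =
      Fintype.card {i // ¬ 0 < hA.eigenvalues i} :=
    Fintype.card_congr <| Equiv.subtypeEquivRight fun i ↦ by
      rw [not_lt, le_iff_lt_or_eq, or_iff_left (hA.eigenvalues_ne_zero_of_isUnit hAu i)]
  rw [Fintype.card_fin] at h hle
  omega

theorem antitonicity_of_same_inertia {n : ℕ} (H₁ H₂ : Matrix (Fin n) (Fin n) ℂ)
    (h1 : H₁.IsHermitian) (h2 : H₂.IsHermitian)
    (hu1 : IsUnit H₁) (hu2 : IsUnit H₂)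
    (hle : (H₂ - H₁).PosSemidef)
    (hpos : posCount H₁ = posCount H₂) (hneg : negCount H₁ = negCount H₂) :
    (H₁⁻¹ - H₂⁻¹).PosSemidef := by
  have hcard := posCount_add_negCount_of_isUnit h1 hu1
  rw [hneg, posCount, negCount, dif_pos h1, dif_pos h2] at hcard
  have hE : (((h1.eigenvectorUnitary : Matrix (Fin n) (Fin n) ℂ).submatrix id
      (Subtype.val : {i // 0 < h1.eigenvalues i} → Fin n))ᴴ * H₁ *
        (h1.eigenvectorUnitary : Matrix (Fin n) (Fin n) ℂ).submatrix id Subtype.val).PosDef := by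
    rw [h1.conjTranspose_submatrix_eigenvectorUnitary_mul_mul Subtype.val_injective]
    exact .diagonal fun i ↦ by exact_mod_cast i.2
  have hF : (((h2.eigenvectorUnitary : Matrix (Fin n) (Fin n) ℂ).submatrix id
      (Subtype.val : {i // h2.eigenvalues i < 0} → Fin n))ᴴ * (-H₂) *
        (h2.eigenvectorUnitary : Matrix (Fin n) (Fin n) ℂ).submatrix id Subtype.val).PosDef := by
    rw [Matrix.mul_neg, Matrix.neg_mul,
      h2.conjTranspose_submatrix_eigenvectorUnitary_mul_mul Subtype.val_injective, diagonal_neg]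
    exact .diagonal fun i ↦ neg_pos.2 (by exact_mod_cast i.2)
  exact posSemidef_inv_sub_inv_of_posDef h1 h2 hu1 hu2 hle hE hF (by simpa using hcard)
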